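/- For every n ≥ 1 and every tuple d = (d_1,…,d_n) of nonnegative integers such that g(d) is a nonnegative integer and 2g(d)−2+n > 0, one has C(d) > 0. -/

import Mathlib

open scoped BigOperators

noncomputable section

namespace WittenAsym

/-- `g(d)` as a rational number: `g(d) = 1 + (∑ⱼ dⱼ − n)/3`. -/
def gQ (l : List ℕ) : ℚ := 1 + ((l.sum : ℚ) - (l.length : ℚ)) / 3

/-- `X(d)` as a rational number: `X(d) = (∑ⱼ (2dⱼ+1))/3 = 2g(d) − 2 + n`. -/
def XQ (l : List ℕ) : ℚ := (2 * (l.sum : ℚ) + (l.length : ℚ)) / 3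

/-- `X(d)` as a natural number (the correct value whenever `X(d)` is an integer). -/
def XN (l : List ℕ) : ℕ := (2 * l.sum + l.length) / 3

/-- `g(d)` is a nonnegative integer. -/
def IntegralG (l : List ℕ) : Prop := ∃ g : ℕ, (g : ℚ) = gQ l

/-- The subtuple of `r` indexed by the finite index set `I`. -/
def select (r : List ℕ) (I : Finset (Fin r.length)) : List ℕ :=
  ((List.finRange r.length).filter (fun i => i ∈ I)).map r.get

/-- The characterization of the normalized Witten intersection numbers
`C(d) = 2^{2g(d)} ∏ⱼ (2dⱼ+1)!! / (3^{2g(d)-2+n} (2g(d)-3+n)!) ∫ ψ₁^{d₁}⋯ψₙ^{dₙ}`: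
they form the unique family of rationals, symmetric in the entries of `d`, vanishing
when `g(d)` is not a nonnegative integer, with `C(0,0,0) = 1/3`, `C(1) = 1/6`,
and satisfying the DVV recursion whenever `X(d) = 2g(d) - 2 + n ≥ 2`. -/
structure IsNormalizedWitten (C : List ℕ → ℚ) : Prop where
  symm : ∀ {l l' : List ℕ}, l.Perm l' → C l = C l'
  init3 : C [0, 0, 0] = 1/3
  init1 : C [1] = 1/6
  vanish : ∀ l : List ℕ, ¬ IntegralG l → C l = 0
  dvv : ∀ (d₁ : ℕ) (r : List ℕ), IntegralG (d₁ :: r) → 2 ≤ XQ (d₁ :: r) →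
    C (d₁ :: r) =
      (∑ j : Fin r.length,
        if 1 ≤ d₁ + r.get j then
          (2 * (r.get j : ℚ) + 1) / (3 * (XQ (d₁ :: r) - 1)) *
            C (r.set j.val (d₁ + r.get j - 1))
        else 0)
      + ∑ a ∈ Finset.range (d₁ - 1),
          (2 / (3 * (XQ (d₁ :: r) - 1)) * C (a :: (d₁ - 2 - a) :: r)
          + ∑ I : Finset (Fin r.length),
              if 3 ∣ (2 * (a + (select r I).sum) + (1 + (select r I).length)) then
                ((XN (a :: select r I) - 1).factorial : ℚ) *
                  ((XN ((d₁ - 2 - a) :: select r Iᶜ) - 1).factorial : ℚ) /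
                  (6 * ((XN (d₁ :: r) - 1).factorial : ℚ)) *
                  C (a :: select r I) * C ((d₁ - 2 - a) :: select r Iᶜ)
              else 0)

theorem integralG_iff (l : List ℕ) : IntegralG l ↔ ∃ g : ℕ, 3 * g + l.length = 3 + l.sum := by
  unfold IntegralG gQ
  refine exists_congr fun g => ?_
  constructor
  · intro h
    have : (3 * g + l.length : ℚ) = 3 + l.sum := by rw [h]; ring
    exact_mod_cast this
  · intro h
    have : (3 * g + l.length : ℚ) = 3 + l.sum := by exact_mod_cast h
    linarith

theorem sum_set_add (r : List ℕ) (j : Fin r.length) (v : ℕ) :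
    (r.set j.val v).sum + r.get j = r.sum + v := by
  induction r with
  | nil => exact j.elim0
  | cons a t ih =>
    refine Fin.cases ?_ (fun i => ?_) j
    · simp; ring
    · have := ih i
      simp at this ⊢
      omega

theorem select_sublist (r : List ℕ) (I : Finset (Fin r.length)) : (select r I).Sublist r := by
  have h : ((List.finRange r.length).filter (fun i => i ∈ I)).Sublist (List.finRange r.length) :=
    List.filter_sublist
  have h2 := h.map r.get
  have h3 : (List.finRange r.length).map r.get = r := by simp
  rw [h3] at h2
  exact h2

theorem pos_aux (C : List ℕ → ℚ) (hC : IsNormalizedWitten C) :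
    ∀ N : ℕ, ∀ l : List ℕ, l ≠ [] → 2 * l.sum + l.length = N → IntegralG l → 0 < C l := by
  intro N
  induction N using Nat.strong_induction_on with
  | _ N ih =>
  intro l hl hN hg
  have nn : ∀ m : List ℕ, m ≠ [] → 2 * m.sum + m.length < N → 0 ≤ C m := by
    intro m hm hlt
    by_cases h : IntegralG m
    · exact (ih _ hlt m hm rfl h).le
    · exact (hC.vanish m h).ge
  by_cases hz : ∀ x ∈ l, x = 0
  · have hs : l.sum = 0 := List.sum_eq_zero hz
    obtain ⟨g, hg⟩ := (integralG_iff l).1 hg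
    have hpos := List.length_pos_iff.2 hl
    have h3 : l.length = 3 := by omega
    have : l = [0, 0, 0] := by
      rw [List.eq_replicate_of_mem hz, h3]; rfl
    rw [this, hC.init3]; norm_num
  push Not at hz
  obtain ⟨d, hd, hd0⟩ := hz
  obtain ⟨r, hr⟩ : ∃ r, l.Perm (d :: r) := ⟨_, List.perm_cons_erase hd⟩
  rw [hC.symm hr]
  have hsum : l.sum = d + r.sum := by rw [hr.sum_eq]; simp
  have hlen : l.length = r.length + 1 := by rw [hr.length_eq]; simp
  obtain ⟨g, hg'⟩ := (integralG_iff l).1 hg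
  have hI : IntegralG (d :: r) := (integralG_iff _).2 ⟨g, by simp; omega⟩
  by_cases h1 : d = 1 ∧ r = []
  · obtain ⟨rfl, rfl⟩ := h1
    rw [hC.init1]; norm_num
  have hX6 : 6 ≤ 2 * (d + r.sum) + (r.length + 1) := by
    by_cases hr0 : r = []
    · subst hr0
      simp at h1 hsum hlen ⊢
      omega
    · have := List.length_pos_iff.2 hr0
      omega
  have hX : 2 ≤ XQ (d :: r) := by
    unfold XQ
    have : (6 : ℚ) ≤ 2 * (d + r.sum) + (r.length + 1) := by exact_mod_cast hX6
    rw [List.sum_cons, List.length_cons]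
    rw [Nat.cast_add, Nat.cast_add, Nat.cast_one]
    linarith
  rw [hC.dvv d r hI hX]
  have hX1 : 0 < 3 * (XQ (d :: r) - 1) := by linarith
  have hA : ∀ j ∈ (Finset.univ : Finset (Fin r.length)), (0 : ℚ) ≤
      if 1 ≤ d + r.get j then
          (2 * (r.get j : ℚ) + 1) / (3 * (XQ (d :: r) - 1)) *
            C (r.set j.val (d + r.get j - 1))
        else 0 := by
    intro j _
    split_ifs with hj
    · apply mul_nonneg
      · positivity
      · apply nn
        · intro h
          have h5 := congrArg List.length h
          have h6 := j.2
          rw [List.length_set, List.length_nil] at h5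
          omega
        · have := sum_set_add r j (d + r.get j - 1)
          rw [List.length_set]
          omega
    · exact le_rfl
  have hB1 : ∀ a ∈ Finset.range (d - 1),
      0 ≤ 2 / (3 * (XQ (d :: r) - 1)) * C (a :: (d - 2 - a) :: r) := by
    intro a ha
    rw [Finset.mem_range] at ha
    apply mul_nonneg
    · positivity
    · apply nn _ (by simp)
      simp
      omega
  have hB2 : ∀ a ∈ Finset.range (d - 1), (0 : ℚ) ≤ ∑ I : Finset (Fin r.length),
              if 3 ∣ (2 * (a + (select r I).sum) + (1 + (select r I).length)) then
                ((XN (a :: select r I) - 1).factorial : ℚ) *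
                  ((XN ((d - 2 - a) :: select r Iᶜ) - 1).factorial : ℚ) /
                  (6 * ((XN (d :: r) - 1).factorial : ℚ)) *
                  C (a :: select r I) * C ((d - 2 - a) :: select r Iᶜ)
              else 0 := by
    intro a ha
    rw [Finset.mem_range] at ha
    apply Finset.sum_nonneg
    intro I _
    have key : ∀ (b : ℕ) (J : Finset (Fin r.length)), b + 2 ≤ d → 0 ≤ C (b :: select r J) := by
      intro b J hb
      apply nn _ (by simp)
      have h1 := (select_sublist r J).length_le
      have h2 := (select_sublist r J).sum_le_sum (by simp)
      simp
      omega
    split_ifs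
    · have k1 := key a I (by omega)
      have k2 := key (d - 2 - a) Iᶜ (by omega)
      exact mul_nonneg (mul_nonneg (by positivity) k1) k2
    · exact le_rfl
  have hB : ∀ a ∈ Finset.range (d - 1), _ := fun a ha => add_nonneg (hB1 a ha) (hB2 a ha)
  by_cases hr0 : r = []
  · apply add_pos_of_nonneg_of_pos (Finset.sum_nonneg hA)
    have hd4 : 4 ≤ d := by
      subst hr0
      simp at h1 hsum hlen
      omega
    have h0 : 0 ∈ Finset.range (d - 1) := by rw [Finset.mem_range]; omega
    refine Finset.sum_pos' hB ⟨0, h0, add_pos_of_pos_of_nonneg ?_ (hB2 0 h0)⟩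
    apply mul_pos (by positivity)
    subst hr0
    simp at hsum hlen
    refine ih _ ?_ _ (by simp) rfl ((integralG_iff _).2 ⟨g - 1, ?_⟩)
    · simp; omega
    · simp; omega
  · refine add_pos_of_pos_of_nonneg ?_ (Finset.sum_nonneg hB)
    have hp := List.length_pos_iff.2 hr0
    refine Finset.sum_pos' hA ⟨⟨0, hp⟩, Finset.mem_univ _, ?_⟩
    rw [if_pos (by omega)]
    apply mul_pos (by positivity)
    have hs := sum_set_add r ⟨0, hp⟩ (d + r.get ⟨0, hp⟩ - 1)
    refine ih _ ?_ _ ?_ rfl ((integralG_iff _).2 ⟨g, ?_⟩)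
    · rw [List.length_set]; omega
    · intro h
      have := congrArg List.length h
      simp at this
      exact hr0 this
    · rw [List.length_set]; omega

/-- Positivity: `C(d) > 0` whenever `g(d)` is a nonnegative integer and
`2g(d) − 2 + n > 0`. -/
theorem positivity (C : List ℕ → ℚ) (hC : IsNormalizedWitten C) :
    ∀ l : List ℕ, l ≠ [] → ∀ g : ℕ, (g : ℚ) = gQ l → 2 < 2 * g + l.length →
      0 < C l := by
  intro l hl g hg _
  exact pos_aux C hC _ l hl rfl ⟨g, hg⟩

end WittenAsym
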